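/- Let 𝔇 = (S, s₀, K, 𝔓) be a family of MCs, G ⊆ S, and λ ∈ [0,1]. There exists a realisation r ∈ R^𝔇 with Prob(D_r, ◇G) ≤ λ if and only if there exists a memoryless deterministic scheduler σ of the all-in-one MDP M^𝔇 such that the reachability probability, in the trajectory measure of the MC induced by σ started at 'none', of the lifted goal set {some (s, r') | s ∈ G, r' ∈ R^𝔇} is at most λ. -/

import Mathlib

open MeasureTheory
open scoped ENNReal NNReal Classical

/-- A family of Markov chains `𝔇 = (S, s₀, K, 𝔓)`: finite state space `S`,
initial state `s₀`, finite parameter set `K` with nonempty finite domains `T k ⊆ S`,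
and a parametric transition function `𝔓 : S → Distr(K)`. -/
structure MCFamily (S K : Type) [Fintype S] [Fintype K] where
  s0 : S
  T : K → Finset S
  T_nonempty : ∀ k, (T k).Nonempty
  P : S → PMF K

variable {S K : Type} [Fintype S] [Fintype K]

/-- The set `R^𝔇` of realisations of the family. -/
def Realisations (𝔇 : MCFamily S K) : Set (K → S) :=
  {r | ∀ k, r k ∈ 𝔇.T k}

/-- Transition matrix of the Markov chain `D_r` induced by realisation `r`:
at state `s` it is the pushforward of `𝔓(s)` under `r`. -/
noncomputable def familyTrans (𝔇 : MCFamily S K) (r : K → S) (s : S) : PMF S :=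
  (𝔇.P s).map r

/-- The `k`-th binary digit of the fractional part of `u`. -/
noncomputable def bit (k : ℕ) (u : ℝ) : ℕ := ⌊u * 2 ^ (k + 1)⌋.toNat % 2

/-- From one uniform `u ∈ [0,1)`, extract the `i`-th member of an i.i.d. sequence of
uniform random variables, by de-interleaving binary digits. -/
noncomputable def uSlice (i : ℕ) (u : ℝ) : ℝ :=
  ∑' k : ℕ, (bit (Nat.pair i k) u : ℝ) / 2 ^ (k + 1)

/-- Cumulative distribution values of a PMF on a finite type, w.r.t. a fixed enumeration. -/
noncomputable def cumul {σ : Type} [Fintype σ] (P : PMF σ) (j : ℕ) : ℝ :=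
  ∑ i ∈ Finset.univ.filter (fun i : Fin (Fintype.card σ) => (i : ℕ) < j),
    (P ((Fintype.equivFin σ).symm i)).toReal

/-- Inverse-CDF sampling: if `u` is uniform on `[0,1)` then `sample P u` has law `P`. -/
noncomputable def sample {σ : Type} [Fintype σ] [Nonempty σ] (P : PMF σ) (u : ℝ) : σ :=
  (Fintype.equivFin σ).symm <|
    if h : (Finset.univ.filter fun j : Fin (Fintype.card σ) =>
        u < cumul P ((j : ℕ) + 1)).Nonempty then
      (Finset.univ.filter fun j : Fin (Fintype.card σ) =>
        u < cumul P ((j : ℕ) + 1)).min' h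
    else ⟨0, Fintype.card_pos⟩

/-- Simulation of the Markov chain with transition function `P` started in `init`,
driven by the i.i.d. uniform sequence extracted from `u`. -/
noncomputable def simTraj {σ : Type} [Fintype σ] [Nonempty σ]
    (P : σ → PMF σ) (init : σ) (u : ℝ) : ℕ → σ
  | 0 => init
  | n + 1 => sample (P (simTraj P init u n)) (uSlice n u)

/-- The law of the trajectories (`ℕ → σ` with the product of discrete σ-algebras) of the
Markov chain with transition function `P` and initial distribution `δ_init`; it is obtained
as the pushforward of the uniform distribution on `[0,1)` under the simulation map, which
coincides with the measure given by the Ionescu–Tulcea construction. -/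
noncomputable def trajMeasure {σ : Type} [Fintype σ] [Nonempty σ]
    (P : σ → PMF σ) (init : σ) :
    @Measure (ℕ → σ) (@MeasurableSpace.pi ℕ (fun _ => σ) (fun _ => ⊤)) :=
  @Measure.map ℝ (ℕ → σ) _ (@MeasurableSpace.pi ℕ (fun _ => σ) (fun _ => ⊤))
    (simTraj P init) ((volume : Measure ℝ).restrict (Set.Ico 0 1))

/-- Reachability probability `Prob(·, ◇G)`. -/
noncomputable def reachProb {σ : Type} [Fintype σ] [Nonempty σ]
    (P : σ → PMF σ) (init : σ) (G : Set σ) : ℝ≥0∞ :=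
  trajMeasure P init {ω | ∃ n, ω n ∈ G}

/-- Expected reward accumulated before reaching `G`. -/
noncomputable def expReward {σ : Type} [Fintype σ] [Nonempty σ]
    (P : σ → PMF σ) (init : σ) (G : Set σ) (rew : σ → ℝ≥0) : ℝ≥0∞ :=
  ∫⁻ ω, (∑' n : ℕ, if ∀ m ≤ n, ω m ∉ G then (rew (ω n) : ℝ≥0∞) else 0)
    ∂(trajMeasure P init)

/-- The (sub)type of realisations of the family `𝔇`. -/
abbrev Realz (𝔇 : MCFamily S K) := {r : K → S // ∀ k, r k ∈ 𝔇.T k}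

/-- Transition function of the Markov chain induced on the all-in-one MDP `M^𝔇`
(state space `Option (S × R^𝔇)`, fresh initial state `none`) by the memoryless
deterministic scheduler that selects action `a_r` at `none` (elsewhere only one action
is enabled): from `none` move surely to `some (s₀, r)`; from `some (s, r')` move to
`some (s', r')` with probability `𝔓(r')(s)(s')`. -/
noncomputable def allInOneTrans [DecidableEq S] [DecidableEq K] (𝔇 : MCFamily S K)
    (r : Realz 𝔇) : Option (S × Realz 𝔇) → PMF (Option (S × Realz 𝔇))
  | none => PMF.pure (some (𝔇.s0, r))
  | some (s, r') => ((𝔇.P s).map r'.val).map fun s' => some (s', r')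

/-- The lifted goal set `{some (s, r') | s ∈ G, r' ∈ R^𝔇}` in the all-in-one MDP. -/
def liftedGoal [DecidableEq S] [DecidableEq K] (𝔇 : MCFamily S K) (G : Set S) :
    Set (Option (S × Realz 𝔇)) :=
  {x | ∃ s ∈ G, ∃ r' : Realz 𝔇, x = some (s, r')}

open ProbabilityTheory

/-- The uniform distribution on `[0,1)`. -/
noncomputable def uniformUnit : Measure ℝ := (volume : Measure ℝ).restrict (Set.Ico 0 1)

instance : IsProbabilityMeasure uniformUnit := ⟨by simp [uniformUnit]⟩

lemma ae_mem_Ico_uniformUnit : ∀ᵐ u ∂uniformUnit, u ∈ Set.Ico (0 : ℝ) 1 :=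
  ae_restrict_mem measurableSet_Ico

/-- The uniform distribution is the even mixture of its images under the two inverse branches
of the doubling map. -/
lemma uniformUnit_apply_eq_half {A : Set ℝ} (hA : MeasurableSet A) :
    uniformUnit A = 2⁻¹ * uniformUnit ((fun x ↦ x / 2) ⁻¹' A) +
      2⁻¹ * uniformUnit ((fun x ↦ (x + 1) / 2) ⁻¹' A) := by
  have hscale (B : Set ℝ) : (2⁻¹ : ℝ≥0∞) * volume ((fun x : ℝ ↦ x / 2) ⁻¹' B) = volume B := by
    have h := Real.volume_preimage_mul_right (a := 2⁻¹) (by norm_num) B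
    simp only [inv_inv, abs_two, ENNReal.ofReal_ofNat, ← div_eq_mul_inv] at h
    rw [h, ← mul_assoc, ENNReal.inv_mul_cancel (by norm_num) (by norm_num), one_mul]
  have hlow : (fun x : ℝ ↦ x / 2) ⁻¹' A ∩ Set.Ico 0 1 =
      (fun x : ℝ ↦ x / 2) ⁻¹' (A ∩ Set.Ico 0 (1 / 2)) := by
    ext x
    simp only [Set.mem_inter_iff, Set.mem_preimage, Set.mem_Ico]
    refine and_congr_right fun _ ↦ ⟨fun h ↦ ⟨?_, ?_⟩, fun h ↦ ⟨?_, ?_⟩⟩ <;> linarith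
  have hhigh : (fun x : ℝ ↦ (x + 1) / 2) ⁻¹' A ∩ Set.Ico 0 1 =
      (fun x : ℝ ↦ x + 1) ⁻¹' ((fun x : ℝ ↦ x / 2) ⁻¹' (A ∩ Set.Ico (1 / 2) 1)) := by
    ext x
    simp only [Set.mem_inter_iff, Set.mem_preimage, Set.mem_Ico]
    refine and_congr_right fun _ ↦ ⟨fun h ↦ ⟨?_, ?_⟩, fun h ↦ ⟨?_, ?_⟩⟩ <;> linarith
  rw [uniformUnit, Measure.restrict_apply hA, Measure.restrict_apply (by measurability),
    Measure.restrict_apply (by measurability), hlow, hhigh, measure_preimage_add_right,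
    hscale, hscale, ← measure_union _ (hA.inter measurableSet_Ico), ← Set.inter_union_distrib_left,
    Set.Ico_union_Ico_eq_Ico (by norm_num) (by norm_num)]
  exact (Set.Ico_disjoint_Ico_same).mono Set.inter_subset_right Set.inter_subset_right

/-- The law of a fair binary digit. -/
noncomputable def fairDigit : Measure (Fin 2) :=
  (2⁻¹ : ℝ≥0∞) • Measure.dirac 0 + (2⁻¹ : ℝ≥0∞) • Measure.dirac 1

instance : IsProbabilityMeasure fairDigit := ⟨by simp [fairDigit, ENNReal.inv_two_add_inv_two]⟩

lemma fairDigit_apply (t : Set (Fin 2)) :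
    fairDigit t = 2⁻¹ * t.indicator 1 0 + 2⁻¹ * t.indicator 1 1 := by
  simp [fairDigit]

lemma digits_half_zero {x : ℝ} (hx : x ∈ Set.Ico (0 : ℝ) 1) : Real.digits (x / 2) 2 0 = 0 := by
  have : ⌊x⌋₊ = 0 := Nat.floor_eq_zero.2 hx.2
  simp [Real.digits, this]

lemma digits_half_succ (x : ℝ) (k : ℕ) :
    Real.digits (x / 2) 2 (k + 1) = Real.digits x 2 k := by
  have : x / 2 * (2 : ℕ) ^ (k + 1 + 1) = x * (2 : ℕ) ^ (k + 1) := by push_cast; ring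
  simp only [Real.digits, this]

lemma digits_add_one_half_zero {x : ℝ} (hx : x ∈ Set.Ico (0 : ℝ) 1) :
    Real.digits ((x + 1) / 2) 2 0 = 1 := by
  have : ⌊x⌋₊ = 0 := Nat.floor_eq_zero.2 hx.2
  simp [Real.digits, Nat.floor_add_one hx.1, this]

lemma digits_add_one_half_succ {x : ℝ} (hx : x ∈ Set.Ico (0 : ℝ) 1) (k : ℕ) :
    Real.digits ((x + 1) / 2) 2 (k + 1) = Real.digits x 2 k := by
  have h : (x + 1) / 2 * (2 : ℕ) ^ (k + 1 + 1) = x * (2 : ℕ) ^ (k + 1) + (2 ^ (k + 1) : ℕ) := by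
    push_cast; ring
  have h0 : 0 ≤ x * (2 : ℕ) ^ (k + 1) := mul_nonneg hx.1 (by positivity)
  simp only [Real.digits, h, Nat.floor_add_natCast h0]
  ext
  simp [pow_succ]

lemma measurable_digits (k : ℕ) : Measurable fun u : ℝ ↦ Real.digits u 2 k :=
  (measurable_from_nat (f := Fin.ofNat 2)).comp
    (Nat.measurable_floor.comp (measurable_id.mul_const _))

lemma uniformUnit_forall_digits_mem (n : ℕ) (t : ℕ → Set (Fin 2)) :
    uniformUnit {u | ∀ k < n, Real.digits u 2 k ∈ t k} = ∏ k ∈ Finset.range n, fairDigit (t k) := by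
  induction n generalizing t with
  | zero => simp
  | succ n ih =>
    have hmeas : MeasurableSet {u : ℝ | ∀ k < n + 1, Real.digits u 2 k ∈ t k} := by
      simp only [Set.ofPred_forall]
      exact .iInter fun k ↦ .iInter fun _ ↦ measurable_digits k (.of_discrete)
    have hbranch (φ : ℝ → ℝ) (b : Fin 2)
        (h0 : ∀ x ∈ Set.Ico (0 : ℝ) 1, Real.digits (φ x) 2 0 = b)
        (hs : ∀ x ∈ Set.Ico (0 : ℝ) 1, ∀ k, Real.digits (φ x) 2 (k + 1) = Real.digits x 2 k) :
        uniformUnit (φ ⁻¹' {u | ∀ k < n + 1, Real.digits u 2 k ∈ t k}) =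
          (t 0).indicator 1 b * ∏ k ∈ Finset.range n, fairDigit (t (k + 1)) := by
      rw [← ih fun k ↦ t (k + 1)]
      by_cases hb : b ∈ t 0
      · rw [Set.indicator_of_mem hb, Pi.one_apply, one_mul]
        refine measure_congr ?_
        filter_upwards [ae_mem_Ico_uniformUnit] with x hx
        refine propext ?_
        change (∀ k < n + 1, _) ↔ ∀ k < n, _
        rw [Nat.forall_lt_succ_left, h0 x hx]
        simp only [hs x hx, hb, true_and]
      · rw [Set.indicator_of_notMem hb, zero_mul, measure_eq_zero_iff_ae_notMem]
        filter_upwards [ae_mem_Ico_uniformUnit] with x hx h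
        exact hb (h0 x hx ▸ h 0 n.succ_pos)
    rw [uniformUnit_apply_eq_half hmeas,
      hbranch _ 0 (fun x hx ↦ digits_half_zero hx) (fun x _ k ↦ digits_half_succ x k),
      hbranch _ 1 (fun x hx ↦ digits_add_one_half_zero hx)
        (fun x hx k ↦ digits_add_one_half_succ hx k),
      Finset.prod_range_succ', fairDigit_apply (t 0)]
    ring

lemma uniformUnit_map_digits :
    uniformUnit.map (fun u ↦ Real.digits u 2) = Measure.infinitePi fun _ : ℕ ↦ fairDigit := by
  refine Measure.eq_infinitePi _ fun s t _ ↦ ?_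
  obtain ⟨n, hn⟩ := s.exists_nat_subset_range
  rw [Measure.map_apply (measurable_pi_lambda _ measurable_digits)
    (.pi s.countable_toSet fun _ _ ↦ .of_discrete)]
  have h := uniformUnit_forall_digits_mem n fun k ↦ if k ∈ s then t k else Set.univ
  simp only [apply_ite fairDigit, measure_univ, Finset.prod_ite_mem,
    Finset.inter_eq_right.2 hn] at h
  rw [← h]
  congr 1
  ext u
  simp only [Set.mem_preimage, Set.mem_pi, Finset.mem_coe, Set.mem_ofPred_eq]
  refine ⟨fun hu k _ ↦ ?_, fun hu k hk ↦ ?_⟩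
  · split_ifs with hk
    exacts [hu k hk, trivial]
  · simpa [hk] using hu k (Finset.mem_range.1 (hn hk))

lemma infinitePi_fairDigit_map_ofDigits :
    (Measure.infinitePi fun _ : ℕ ↦ fairDigit).map Real.ofDigits = uniformUnit := by
  rw [← uniformUnit_map_digits, Measure.map_map Real.continuous_ofDigits.measurable
    (measurable_pi_lambda _ measurable_digits)]
  refine (Measure.map_congr (g := id) ?_).trans Measure.map_id
  filter_upwards [ae_mem_Ico_uniformUnit] with u hu
  exact Real.ofDigits_digits one_lt_two hu

lemma uSlice_eq_ofDigits (i : ℕ) (u : ℝ) :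
    uSlice i u = Real.ofDigits fun k ↦ Real.digits u 2 (Nat.pair i k) := by
  simp [uSlice, Real.ofDigits, Real.ofDigitsTerm, bit, Real.digits, div_eq_mul_inv,
    Int.floor_toNat]

lemma measurable_uSlice (i : ℕ) : Measurable (uSlice i) := by
  simp only [funext (uSlice_eq_ofDigits i)]
  exact Real.continuous_ofDigits.measurable.comp
    (measurable_pi_lambda _ fun k ↦ measurable_digits _)

/-- The sequence extracted from one uniform variable is i.i.d. uniform. -/
lemma uniformUnit_map_uSlice :
    uniformUnit.map (fun u i ↦ uSlice i u) = Measure.infinitePi fun _ : ℕ ↦ uniformUnit := by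
  have hcomp : (fun (u : ℝ) (i : ℕ) ↦ uSlice i u) =
      (fun (x : ℕ → ℕ → Fin 2) i ↦ Real.ofDigits (x i)) ∘ (MeasurableEquiv.curry ℕ ℕ (Fin 2)) ∘
        (fun (x : ℕ → Fin 2) (p : ℕ × ℕ) ↦ x (Nat.pairEquiv p)) ∘ fun u ↦ Real.digits u 2 := by
    ext u i
    exact uSlice_eq_ofDigits i u
  have hof : Measurable (Real.ofDigits (b := 2)) := Real.continuous_ofDigits.measurable
  have hdig : Measurable fun u : ℝ ↦ Real.digits u 2 := measurable_pi_lambda _ measurable_digits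
  rw [hcomp, ← Measure.map_map (by fun_prop) (by fun_prop),
    ← Measure.map_map (by fun_prop) (by fun_prop), ← Measure.map_map (by fun_prop) (by fun_prop),
    uniformUnit_map_digits, Measure.map_infinitePi_infinitePi_of_inj Nat.pairEquiv.injective,
    Measure.infinitePi_map_curry fun _ _ : ℕ ↦ fairDigit,
    Measure.infinitePi_map_pi _ fun _ ↦ hof]
  simp only [infinitePi_fairDigit_map_ofDigits]

section Sampling

variable {σ : Type} [Fintype σ]

lemma cumul_zero (P : PMF σ) : cumul P 0 = 0 := by simp [cumul]

lemma cumul_succ (P : PMF σ) (j : Fin (Fintype.card σ)) :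
    cumul P (j + 1) = cumul P j + (P ((Fintype.equivFin σ).symm j)).toReal := by
  have h : Finset.univ.filter (fun i : Fin (Fintype.card σ) ↦ (i : ℕ) < j + 1) =
      insert j (Finset.univ.filter fun i : Fin (Fintype.card σ) ↦ (i : ℕ) < j) := by
    ext i
    simp only [Finset.mem_filter, Finset.mem_univ, true_and, Finset.mem_insert, Fin.ext_iff]
    lia
  rw [cumul, cumul, h, Finset.sum_insert (by simp), add_comm]

lemma cumul_mono (P : PMF σ) : Monotone (cumul P) := fun _ _ hij ↦
  Finset.sum_le_sum_of_subset_of_nonneg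
    (Finset.monotone_filter_right _ fun _ _ h ↦ lt_of_lt_of_le h hij)
    fun _ _ _ ↦ ENNReal.toReal_nonneg

lemma cumul_card (P : PMF σ) : cumul P (Fintype.card σ) = 1 := by
  simp only [cumul, Fin.is_lt, Finset.filter_true]
  rw [Equiv.sum_comp (Fintype.equivFin σ).symm fun s ↦ (P s).toReal,
    ← ENNReal.toReal_sum fun s _ ↦ P.apply_ne_top s, ← tsum_fintype (L := .unconditional σ),
    P.tsum_coe, ENNReal.toReal_one]

variable [Nonempty σ]

lemma sample_eq_iff (P : PMF σ) {u : ℝ} (hu : u ∈ Set.Ico (0 : ℝ) 1) (s : σ) :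
    sample P u = s ↔ u ∈ Set.Ico (cumul P (Fintype.equivFin σ s))
      (cumul P ((Fintype.equivFin σ s : ℕ) + 1)) := by
  have hne : (Finset.univ.filter fun j : Fin (Fintype.card σ) ↦
      u < cumul P ((j : ℕ) + 1)).Nonempty := by
    refine ⟨⟨Fintype.card σ - 1, Nat.sub_lt Fintype.card_pos one_pos⟩, ?_⟩
    rw [Finset.mem_filter, Nat.sub_add_cancel (n := Fintype.card σ) (m := 1) Fintype.card_pos,
      cumul_card]
    exact ⟨Finset.mem_univ _, hu.2⟩
  rw [sample, dif_pos hne, Equiv.symm_apply_eq, Finset.min'_eq_iff]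
  simp only [Finset.mem_filter, Finset.mem_univ, true_and, Set.mem_Ico]
  rw [and_comm]
  refine and_congr_left fun _ ↦ ⟨fun h ↦ ?_, fun h i hi ↦ ?_⟩
  · obtain hj | hj := Nat.eq_zero_or_pos (Fintype.equivFin σ s : ℕ)
    · rw [hj, cumul_zero]
      exact hu.1
    · by_contra! hlt
      have := h ⟨Fintype.equivFin σ s - 1, by lia⟩ (by simpa [Nat.sub_add_cancel hj] using hlt)
      rw [Fin.le_def] at this
      simp only at this
      lia
  · by_contra! hlt
    exact absurd (hi.trans_le (cumul_mono P (Nat.succ_le_of_lt (Fin.lt_def.1 hlt)))) h.not_gt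

lemma measurable_sample [MeasurableSpace σ] (P : PMF σ) : Measurable (sample P) := by
  have hpred : Measurable fun (u : ℝ) (j : Fin (Fintype.card σ)) ↦ u < cumul P ((j : ℕ) + 1) :=
    measurable_pi_lambda _ fun j ↦ measurableSet_setOfPred.1 measurableSet_Iio
  let choose (p : Fin (Fintype.card σ) → Prop) : σ :=
    (Fintype.equivFin σ).symm <|
      if h : (Finset.univ.filter p).Nonempty then (Finset.univ.filter p).min' h
      else ⟨0, Fintype.card_pos⟩
  have hsample : sample P = choose ∘ fun u j ↦ u < cumul P ((j : ℕ) + 1) := by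
    ext u
    simp only [sample, choose, Function.comp_apply]
  rw [hsample]
  exact (measurable_of_finite choose).comp hpred

lemma uniformUnit_sample_eq (P : PMF σ) (s : σ) : uniformUnit {u | sample P u = s} = P s := by
  have hsub : Set.Ico (cumul P (Fintype.equivFin σ s))
      (cumul P ((Fintype.equivFin σ s : ℕ) + 1)) ⊆ Set.Ico 0 1 :=
    Set.Ico_subset_Ico (cumul_zero P ▸ cumul_mono P (Nat.zero_le _))
      (cumul_card P ▸ cumul_mono P (Fin.is_lt _))
  have hae : {u | sample P u = s} =ᵐ[uniformUnit] Set.Ico (cumul P (Fintype.equivFin σ s))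
      (cumul P ((Fintype.equivFin σ s : ℕ) + 1)) := by
    filter_upwards [ae_mem_Ico_uniformUnit] with u hu
    exact propext (sample_eq_iff P hu s)
  rw [measure_congr hae, uniformUnit, Measure.restrict_apply measurableSet_Ico,
    Set.inter_eq_left.2 hsub, Real.volume_Ico, cumul_succ, add_sub_cancel_left,
    Equiv.symm_apply_apply, ENNReal.ofReal_toReal (P.apply_ne_top s)]

end Sampling

section DrivenChain

variable {σ : Type} [Fintype σ] [Nonempty σ]

/-- The Markov chain simulated from a sequence of uniform variables. -/
noncomputable def drivenChain (P : σ → PMF σ) (init : σ) (z : ℕ → ℝ) : ℕ → σ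
  | 0 => init
  | n + 1 => sample (P (drivenChain P init z n)) (z n)

lemma simTraj_eq_drivenChain (P : σ → PMF σ) (init : σ) (u : ℝ) :
    simTraj P init u = drivenChain P init fun i ↦ uSlice i u := by
  ext n
  induction n with
  | zero => rfl
  | succ n ih => simp only [simTraj, drivenChain, ih]

lemma measurable_drivenChain [MeasurableSpace σ] [DiscreteMeasurableSpace σ] (P : σ → PMF σ)
    (init : σ) (n : ℕ) : Measurable fun z ↦ drivenChain P init z n := by
  induction n with
  | zero => exact measurable_const
  | succ n ih =>
    have h : Measurable fun p : σ × ℝ ↦ sample (P p.1) p.2 :=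
      measurable_from_prod_countable_right fun s ↦ measurable_sample (P s)
    have hpair : Measurable fun z : ℕ → ℝ ↦ (drivenChain P init z n, z n) :=
      ih.prodMk (measurable_pi_apply n)
    have hcomp : (fun z ↦ drivenChain P init z (n + 1)) =
        (fun p : σ × ℝ ↦ sample (P p.1) p.2) ∘ fun z : ℕ → ℝ ↦ (drivenChain P init z n, z n) := rfl
    rw [hcomp]
    exact h.comp hpair

lemma drivenChain_congr (P : σ → PMF σ) (init : σ) {z w : ℕ → ℝ} {n : ℕ}
    (h : ∀ i < n, z i = w i) : drivenChain P init z n = drivenChain P init w n := by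
  induction n with
  | zero => rfl
  | succ n ih =>
    simp only [drivenChain, ih fun i hi ↦ h i (hi.trans n.lt_succ_self), h n n.lt_succ_self]

/-- The event that the chain sits in `s` at time `n`, having avoided `G` up to then. -/
def avoidEvent (P : σ → PMF σ) (init : σ) (G : Set σ) (n : ℕ) (s : σ) : Set (ℕ → ℝ) :=
  {z | drivenChain P init z n = s ∧ ∀ i ≤ n, drivenChain P init z i ∉ G}

lemma measurableSet_drivenChain_avoid (P : σ → PMF σ) (init : σ) (G : Set σ) (n : ℕ) :
    MeasurableSet {z | ∀ i ≤ n, drivenChain P init z i ∉ G} := by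
  let _ : MeasurableSpace σ := ⊤
  simp only [Set.ofPred_forall]
  exact .iInter fun i ↦ .iInter fun _ ↦
    (measurable_drivenChain P init i (MeasurableSpace.measurableSet_top (s := G))).compl

lemma measurableSet_avoidEvent (P : σ → PMF σ) (init : σ) (G : Set σ) (n : ℕ) (s : σ) :
    MeasurableSet (avoidEvent P init G n s) := by
  let _ : MeasurableSpace σ := ⊤
  exact MeasurableSet.inter (s₁ := {z | drivenChain P init z n = s})
    (measurable_drivenChain P init n (MeasurableSpace.measurableSet_top (s := {s})))
    (measurableSet_drivenChain_avoid P init G n)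

/-- The probability that the chain with transition function `P` started in `init` sits in a given
state at time `n`, having avoided `G` up to then. -/
noncomputable def avoidProb (P : σ → PMF σ) (init : σ) (G : Set σ) : ℕ → σ → ℝ≥0∞
  | 0, s => if s ∈ G then 0 else PMF.pure init s
  | n + 1, s' => if s' ∈ G then 0 else ∑ s, avoidProb P init G n s * P s s'

/-- The law of an i.i.d. sequence of uniform variables. -/
noncomputable abbrev uniformSeq : Measure (ℕ → ℝ) := Measure.infinitePi fun _ ↦ uniformUnit

/-- An event determined by the coordinates before `n` is independent of the coordinate `n`. -/
lemma uniformSeq_inter_eval {n : ℕ} {A : Set (ℕ → ℝ)} (hA : MeasurableSet A)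
    (hdep : ∀ z w : ℕ → ℝ, (∀ i < n, z i = w i) → z ∈ A → w ∈ A) {B : Set ℝ}
    (hB : MeasurableSet B) :
    uniformSeq (A ∩ {z | z n ∈ B}) = uniformSeq A * uniformUnit B := by
  have hindep : iIndepFun (fun (i : ℕ) (z : ℕ → ℝ) ↦ z i) uniformSeq :=
    iIndepFun_infinitePi (X := fun _ x ↦ x) fun _ ↦ measurable_id
  let extend (x : Finset.range n → ℝ) (i : ℕ) : ℝ :=
    if h : i ∈ Finset.range n then x ⟨i, h⟩ else 0
  have hextend : Measurable extend := by
    refine measurable_pi_lambda _ fun i ↦ ?_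
    by_cases h : i ∈ Finset.range n
    · simp only [extend, h, dite_true]
      exact measurable_pi_apply _
    · simp only [extend, h, dite_false]
      exact measurable_const
  have hpre : (fun (z : ℕ → ℝ) (i : Finset.range n) ↦ z i) ⁻¹' (extend ⁻¹' A) = A := by
    ext z
    refine ⟨hdep _ _ fun i hi ↦ ?_, hdep _ _ fun i hi ↦ ?_⟩ <;>
      simp [extend, hi]
  have hfin := hindep.indepFun_finset (Finset.range n) {n} (by simp) fun i ↦ measurable_pi_apply i
  have h := hfin.measure_inter_preimage_eq_mul _ _ (hextend hA)
    (measurable_pi_apply ⟨n, Finset.mem_singleton_self n⟩ hB)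
  rw [hpre] at h
  have heval : uniformSeq {z | z n ∈ B} = uniformUnit B :=
    (measurePreserving_eval_infinitePi (fun _ : ℕ ↦ uniformUnit) n).measure_preimage
      hB.nullMeasurableSet
  rw [← heval]
  exact h

lemma uniformSeq_avoidEvent (P : σ → PMF σ) (init : σ) (G : Set σ) (n : ℕ) (s : σ) :
    uniformSeq (avoidEvent P init G n s) = avoidProb P init G n s := by
  let _ : MeasurableSpace σ := ⊤
  induction n generalizing s with
  | zero =>
    by_cases hs : s ∈ G
    · have : avoidEvent P init G 0 s = ∅ :=
        Set.eq_empty_of_forall_notMem fun z hz ↦ hz.2 0 le_rfl (hz.1 ▸ hs)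
      simp [this, avoidProb, hs]
    · obtain rfl | h := eq_or_ne s init
      · simp [avoidEvent, avoidProb, drivenChain, hs]
      · simp [avoidEvent, avoidProb, drivenChain, h, h.symm]
  | succ n ih =>
    by_cases hs : s ∈ G
    · have : avoidEvent P init G (n + 1) s = ∅ :=
        Set.eq_empty_of_forall_notMem fun z hz ↦ hz.2 _ le_rfl (hz.1 ▸ hs)
      simp [this, avoidProb, hs]
    · have hB (s₁ : σ) : MeasurableSet {u | sample (P s₁) u = s} :=
        measurable_sample (P s₁) (MeasurableSpace.measurableSet_top (s := {s}))
      have hunion : avoidEvent P init G (n + 1) s =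
          ⋃ s₁, avoidEvent P init G n s₁ ∩ {z | z n ∈ {u | sample (P s₁) u = s}} := by
        ext z
        simp only [avoidEvent, Set.mem_iUnion, Set.mem_inter_iff, Set.mem_ofPred_eq]
        constructor
        · rintro ⟨h1, h2⟩
          exact ⟨_, ⟨rfl, fun i hi ↦ h2 i (hi.trans n.le_succ)⟩, h1⟩
        · rintro ⟨_, ⟨rfl, h2⟩, h1⟩
          refine ⟨h1, fun i hi ↦ ?_⟩
          obtain hi | rfl := Nat.le_succ_iff.1 hi
          · exact h2 i hi
          · exact (show drivenChain P init z (n + 1) = s from h1) ▸ hs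
      have hdisj : Pairwise (Function.onFun Disjoint fun s₁ ↦
          avoidEvent P init G n s₁ ∩ {z | z n ∈ {u | sample (P s₁) u = s}}) :=
        fun a b hab ↦ Set.disjoint_left.2 fun z hz hz' ↦ hab (hz.1.1.symm.trans hz'.1.1)
      rw [hunion, measure_iUnion hdisj fun s₁ ↦ (measurableSet_avoidEvent P init G n s₁).inter
        (measurable_pi_apply n (hB s₁)), tsum_fintype, avoidProb, if_neg hs]
      refine Finset.sum_congr rfl fun s₁ _ ↦ ?_
      rw [uniformSeq_inter_eval (measurableSet_avoidEvent P init G n s₁) _ (hB s₁), ih,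
        uniformUnit_sample_eq]
      rintro z w hzw ⟨h1, h2⟩
      refine ⟨(drivenChain_congr P init hzw).symm.trans h1, fun i hi ↦ ?_⟩
      rw [← drivenChain_congr P init fun j hj ↦ hzw j (hj.trans_le hi)]
      exact h2 i hi

lemma uniformSeq_forall_notMem (P : σ → PMF σ) (init : σ) (G : Set σ) (n : ℕ) :
    uniformSeq {z | ∀ i ≤ n, drivenChain P init z i ∉ G} = ∑ s, avoidProb P init G n s := by
  have hunion : {z | ∀ i ≤ n, drivenChain P init z i ∉ G} = ⋃ s, avoidEvent P init G n s := by
    ext z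
    simp [avoidEvent]
  rw [hunion, measure_iUnion (fun a b hab ↦ Set.disjoint_left.2
    fun z hz hz' ↦ hab (hz.1.symm.trans hz'.1)) (measurableSet_avoidEvent P init G n),
    tsum_fintype]
  simp only [uniformSeq_avoidEvent]

lemma reachProb_eq_uniformSeq (P : σ → PMF σ) (init : σ) (G : Set σ) :
    reachProb P init G = uniformSeq {z | ∃ n, drivenChain P init z n ∈ G} := by
  let _ : MeasurableSpace σ := ⊤
  have hslice : Measurable fun (u : ℝ) (i : ℕ) ↦ uSlice i u :=
    measurable_pi_lambda _ measurable_uSlice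
  have hchain : Measurable (drivenChain P init) :=
    measurable_pi_lambda _ (measurable_drivenChain P init)
  have hreach : MeasurableSet {ω : ℕ → σ | ∃ n, ω n ∈ G} := by
    simp only [Set.ofPred_exists]
    exact .iUnion fun n ↦ measurable_pi_apply n (MeasurableSpace.measurableSet_top (s := G))
  have hsim : simTraj P init = drivenChain P init ∘ fun u i ↦ uSlice i u :=
    funext (simTraj_eq_drivenChain P init)
  change uniformUnit.map (simTraj P init) _ = _
  rw [hsim, ← Measure.map_map hchain hslice, uniformUnit_map_uSlice,
    Measure.map_apply hchain hreach]
  rfl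

lemma reachProb_eq_one_sub_iInf (P : σ → PMF σ) (init : σ) (G : Set σ) :
    reachProb P init G = 1 - ⨅ n, ∑ s, avoidProb P init G n s := by
  have hinter : {z | ∃ n, drivenChain P init z n ∈ G} =
      (⋂ n, {z | ∀ i ≤ n, drivenChain P init z i ∉ G})ᶜ := by
    ext z
    simp only [Set.mem_ofPred_eq, Set.mem_compl_iff, Set.mem_iInter]
    push Not
    exact ⟨fun ⟨n, hn⟩ ↦ ⟨n, n, le_rfl, hn⟩, fun ⟨_, n, _, hn⟩ ↦ ⟨n, hn⟩⟩
  have hanti : Antitone fun n ↦ {z | ∀ i ≤ n, drivenChain P init z i ∉ G} :=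
    fun m n hmn z hz i hi ↦ hz i (hi.trans hmn)
  rw [reachProb_eq_uniformSeq, hinter, prob_compl_eq_one_sub
    (.iInter (measurableSet_drivenChain_avoid P init G)), Antitone.measure_iInter hanti
    (fun n ↦ (measurableSet_drivenChain_avoid P init G n).nullMeasurableSet)
    ⟨0, measure_ne_top _ _⟩]
  simp only [uniformSeq_forall_notMem]

lemma antitone_sum_avoidProb (P : σ → PMF σ) (init : σ) (G : Set σ) :
    Antitone fun n ↦ ∑ s, avoidProb P init G n s := by
  intro m n hmn
  simp only [← uniformSeq_forall_notMem]
  exact measure_mono fun z hz i hi ↦ hz i (hi.trans hmn)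

end DrivenChain

section AllInOne

variable [DecidableEq S] [DecidableEq K]

lemma some_mem_liftedGoal (𝔇 : MCFamily S K) (G : Set S) (s : S) (r : Realz 𝔇) :
    some (s, r) ∈ liftedGoal 𝔇 G ↔ s ∈ G :=
  ⟨by rintro ⟨_, hs, _, ⟨⟩⟩; exact hs, fun hs ↦ ⟨s, hs, r, rfl⟩⟩

lemma none_notMem_liftedGoal (𝔇 : MCFamily S K) (G : Set S) : none ∉ liftedGoal 𝔇 G := by
  simp [liftedGoal]

lemma allInOneTrans_some_none (𝔇 : MCFamily S K) (r r' : Realz 𝔇) (s : S) :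
    allInOneTrans 𝔇 r (some (s, r')) none = 0 := by
  simp [allInOneTrans]

lemma allInOneTrans_some_some (𝔇 : MCFamily S K) (r r' r'' : Realz 𝔇) (s s' : S) :
    allInOneTrans 𝔇 r (some (s, r')) (some (s', r'')) =
      if r'' = r' then familyTrans 𝔇 r' s s' else 0 := by
  change ((familyTrans 𝔇 r' s).map fun x ↦ some (x, r')) (some (s', r'')) = _
  split_ifs with h
  · subst h
    rw [PMF.map_apply, tsum_eq_single s' (by simp +contextual [eq_comm])]
    simp
  · simp [PMF.map_apply, h]

lemma avoidProb_allInOneTrans_succ (𝔇 : MCFamily S K) (G : Set S) (r : Realz 𝔇) (n : ℕ) :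
    avoidProb (allInOneTrans 𝔇 r) none (liftedGoal 𝔇 G) (n + 1) none = 0 ∧
      ∀ (s : S) (r' : Realz 𝔇),
        avoidProb (allInOneTrans 𝔇 r) none (liftedGoal 𝔇 G) (n + 1) (some (s, r')) =
          if r' = r then avoidProb (familyTrans 𝔇 r) 𝔇.s0 G n s else 0 := by
  induction n with
  | zero =>
    constructor
    · simp [avoidProb, Fintype.sum_option, none_notMem_liftedGoal, allInOneTrans]
    · intro s r'
      by_cases hs : s ∈ G
      · simp [avoidProb, some_mem_liftedGoal, hs]
      · simp [avoidProb, Fintype.sum_option, some_mem_liftedGoal, none_notMem_liftedGoal, hs,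
          allInOneTrans, PMF.pure_apply, ← ite_and, and_comm]
  | succ n ih =>
    obtain ⟨ih₀, ih⟩ := ih
    constructor
    · rw [avoidProb, if_neg (none_notMem_liftedGoal 𝔇 G), Fintype.sum_option, ih₀]
      simp [allInOneTrans_some_none]
    · intro s' r'
      rw [avoidProb, Fintype.sum_option, ih₀, Fintype.sum_prod_type]
      simp only [ih, allInOneTrans_some_some, some_mem_liftedGoal, zero_mul, zero_add, ite_mul,
        Finset.sum_ite_eq', Finset.mem_univ, if_true]
      split_ifs <;> simp_all [avoidProb]

lemma reachProb_allInOneTrans [Nonempty S] (𝔇 : MCFamily S K) (G : Set S) (r : Realz 𝔇) :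
    reachProb (allInOneTrans 𝔇 r) none (liftedGoal 𝔇 G) =
      reachProb (familyTrans 𝔇 r) 𝔇.s0 G := by
  rw [reachProb_eq_one_sub_iInf, reachProb_eq_one_sub_iInf,
    ← (antitone_sum_avoidProb (allInOneTrans 𝔇 r) none (liftedGoal 𝔇 G)).iInf_nat_add 1]
  simp [avoidProb_allInOneTrans_succ, Fintype.sum_option, Fintype.sum_prod_type]

end AllInOne

/-- Feasibility via the all-in-one MDP: some family member satisfies
`P_{≤λ}(◇G)` iff some memoryless deterministic scheduler of the all-in-one MDP reaches
the lifted goal set from `none` with probability at most `λ`. -/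
theorem feasibility_iff_allInOne_scheduler [DecidableEq S] [DecidableEq K] [Nonempty S]
    (𝔇 : MCFamily S K) (G : Set S) (lam : ℝ≥0∞) (hlam : lam ≤ 1) :
    (∃ r ∈ Realisations 𝔇, reachProb (familyTrans 𝔇 r) 𝔇.s0 G ≤ lam) ↔
    (∃ r : Realz 𝔇, reachProb (allInOneTrans 𝔇 r) none (liftedGoal 𝔇 G) ≤ lam) := by
  simp only [reachProb_allInOneTrans]
  exact ⟨fun ⟨r, hr, h⟩ ↦ ⟨⟨r, hr⟩, h⟩, fun ⟨r, h⟩ ↦ ⟨r, r.2, h⟩⟩
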